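/- Let F be a properly parametrized Markov multi-map with forward trajectory system (X,T) and inverse limit system (Y,S). If (X,T) is topologically transitive, then (Y,S) is topologically transitive. -/

import Mathlib

open Set Topology

/-! ### Generic dynamical notions -/

/-- Topological transitivity of a map. -/
def TopTransitive {α : Type*} [TopologicalSpace α] (T : α → α) : Prop :=
  ∀ U V : Set α, IsOpen U → IsOpen V → U.Nonempty → V.Nonempty →
    ∃ n : ℕ, (T^[n] '' U ∩ V).Nonempty

/-- Topological mixing of a map. -/
def TopMixing {α : Type*} [TopologicalSpace α] (T : α → α) : Prop :=
  ∀ U V : Set α, IsOpen U → IsOpen V → U.Nonempty → V.Nonempty →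
    ∃ N : ℕ, ∀ n, N ≤ n → (T^[n] '' U ∩ V).Nonempty

/-- Density of the set of periodic points of a map. -/
def DensePeriodic {α : Type*} [TopologicalSpace α] (T : α → α) : Prop :=
  Dense {x : α | ∃ p : ℕ, 1 ≤ p ∧ T^[p] x = x}

/-- The metric `d(x,y) = sup_k |x_k - y_k|/(k+1)` on sequence spaces. -/
noncomputable def dseq (x y : ℕ → ℝ) : ℝ := ⨆ k : ℕ, |x k - y k| / ((k : ℝ) + 1)

/-- The specification property for a map `T` with respect to a distance function `d`. -/
def SpecProp {α : Type*} (T : α → α) (d : α → α → ℝ) : Prop :=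
  ∀ ε : ℝ, 0 < ε → ∃ N : ℕ, ∀ l : ℕ, ∀ x : Fin (l + 1) → α, ∀ a b : Fin (l + 1) → ℕ,
    (∀ k, 1 ≤ a k) → (∀ k, a k ≤ b k) →
    (∀ k : Fin l, b k.castSucc < a k.succ ∧ b k.castSucc + N ≤ a k.succ) →
    ∀ p : ℕ, b (Fin.last l) + N ≤ p →
      ∃ z : α, T^[p] z = z ∧
        ∀ k : Fin (l + 1), ∀ i : ℕ, a k ≤ i → i ≤ b k → d (T^[i] z) (T^[i] (x k)) < ε

/-- The length `ℓ` of a (possibly degenerate) interval. -/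
noncomputable def intervalLen (I : Set ℝ) : ℝ := sSup I - sInf I

/-! ### Markov multi-maps -/

/-- A Markov multi-map of the interval, given by a tuple
`(P, A₀, A₁, A₂, D, R, {f_a})` as in the paper, together with the derived data
(inverse maps `g`, interiors `D0`, `R0`, graphs `Gr`, `G0`) which are uniquely
determined by the defining equations below. -/
structure MarkovMultiMap where
  A : Type
  finA : Finite A
  A0 : Set A
  A1 : Set A
  A2 : Set A
  P : Finset ℝ
  D : A → Set ℝ
  R : A → Set ℝ
  f : A → ℝ → ℝ
  g : A → ℝ → ℝ
  D0 : A → Set ℝ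
  R0 : A → Set ℝ
  Gr : A → Set (ℝ × ℝ)
  G0 : A → Set (ℝ × ℝ)
  P_zero : (0 : ℝ) ∈ P
  P_one : (1 : ℝ) ∈ P
  P_sub : (P : Set ℝ) ⊆ Set.Icc 0 1
  A_cover : ∀ a : A, a ∈ A0 ∨ a ∈ A1 ∨ a ∈ A2
  A01 : A0 ∩ A1 = ∅
  A02 : A0 ∩ A2 = ∅
  A12 : A1 ∩ A2 = ∅
  D_A0 : ∀ a ∈ A0, ∃ p ∈ P, ∃ q ∈ P, p < q ∧ (∀ r ∈ P, ¬(p < r ∧ r < q)) ∧ D a = Set.Icc p q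
  D_A12 : ∀ a ∈ A1 ∪ A2, ∃ p ∈ P, D a = {p}
  R_A0 : ∀ a ∈ A0, ∃ u ∈ P, ∃ v ∈ P, u < v ∧ R a = Set.Icc u v
  R_A1 : ∀ a ∈ A1, ∃ u ∈ P, ∃ v ∈ P, u < v ∧ R a = Set.Icc u v ∧
    Set.Icc u v ∩ (P : Set ℝ) = {u, v}
  R_A2 : ∀ a ∈ A2, ∃ u ∈ P, R a = {u}
  f_homeo : ∀ a ∈ A0, ContinuousOn (f a) (D a) ∧ Set.BijOn (f a) (D a) (R a)
  g_A0 : ∀ a ∈ A0, (∀ x ∈ D a, g a (f a x) = x) ∧ ∀ y ∈ R a, g a y ∈ D a ∧ f a (g a y) = y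
  g_A12 : ∀ a ∈ A1 ∪ A2, ∀ y ∈ R a, g a y ∈ D a
  cover : Set.Icc (0 : ℝ) 1 = ⋃ a : A, D a
  D0_A0 : ∀ a ∈ A0, D0 a = interior (D a)
  D0_A12 : ∀ a ∈ A1 ∪ A2, D0 a = D a
  R0_A01 : ∀ a ∈ A0 ∪ A1, R0 a = interior (R a)
  R0_A2 : ∀ a ∈ A2, R0 a = R a
  Gr_A0 : ∀ a ∈ A0, Gr a = {q : ℝ × ℝ | q.1 ∈ D a ∧ q.2 = f a q.1}
  Gr_A12 : ∀ a ∈ A1 ∪ A2, Gr a = (D a) ×ˢ (R a)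
  G0_A0 : ∀ a ∈ A0, G0 a = {q : ℝ × ℝ | q.1 ∈ D0 a ∧ q.2 = f a q.1}
  G0_A1 : ∀ a ∈ A1, G0 a = (D a) ×ˢ (R0 a)
  G0_A2 : ∀ a ∈ A2, G0 a = Gr a

namespace MarkovMultiMap

variable (M : MarkovMultiMap)

/-- The graph `G(F)` of the multi-map. -/
def GF : Set (ℝ × ℝ) := ⋃ a : M.A, M.Gr a

/-- `F` is properly parametrized: the sets `G₀(a)` partition `G(F)`. -/
def ProperlyParametrized : Prop :=
  (⋃ a : M.A, M.G0 a) = M.GF ∧ ∀ a b : M.A, a ≠ b → Disjoint (M.G0 a) (M.G0 b)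

/-- The forward trajectory space `X`. -/
def X : Set (ℕ → ℝ) :=
  {x | (∀ k, x k ∈ Set.Icc (0 : ℝ) 1) ∧ ∀ k, (x k, x (k + 1)) ∈ M.GF}

/-- The left-shift map `T` on the forward trajectory space. -/
def shift : M.X → M.X :=
  fun x => ⟨fun k => x.1 (k + 1), ⟨fun k => x.2.1 (k + 1), fun k => x.2.2 (k + 1)⟩⟩

/-- The inverse trajectory (inverse limit) space `Y`, encoded by `y k = y_{-k}`. -/
def Y : Set (ℕ → ℝ) :=
  {y | (∀ k, y k ∈ Set.Icc (0 : ℝ) 1) ∧ ∀ k, (y (k + 1), y k) ∈ M.GF}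

/-- The right-shift map `S` on the inverse limit space (in the encoding `y k = y_{-k}`). -/
def ishift : M.Y → M.Y :=
  fun y => ⟨fun k => y.1 (k + 1), ⟨fun k => y.2.1 (k + 1), fun k => y.2.2 (k + 1)⟩⟩

/-- The space `X_n` of finite trajectories of length `n`. -/
def finTraj (n : ℕ) : Set (Fin n → ℝ) :=
  {x | (∀ i, x i ∈ Set.Icc (0 : ℝ) 1) ∧
    ∀ i : Fin n, ∀ h : (i : ℕ) + 1 < n, (x i, x ⟨(i : ℕ) + 1, h⟩) ∈ M.GF}

/-- The associated nearest-neighbor SFT `Σ_M`. -/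
def SFT : Set (ℕ → M.A) := {a | ∀ n : ℕ, M.D0 (a (n + 1)) ⊆ M.R0 (a n)}

/-- The word `u` (of length `n`) occurs in some point of `Z`. -/
def WordIn {n : ℕ} (u : Fin n → M.A) (Z : Set (ℕ → M.A)) : Prop :=
  ∃ z ∈ Z, ∃ m : ℕ, ∀ i : Fin n, u i = z (m + (i : ℕ))

/-- `L_n`, the words of length `n` in the language of `Σ_M`. -/
def Lang (n : ℕ) : Set (Fin n → M.A) := {u | M.WordIn u M.SFT}

/-- `(x,u)` is a labeled finite trajectory: `(x_k, x_{k+1}) ∈ G(u_k)` for all `k`. -/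
def Labeled {n : ℕ} (x : Fin (n + 1) → ℝ) (u : Fin n → M.A) : Prop :=
  ∀ i : Fin n, (x i.castSucc, x i.succ) ∈ M.Gr (u i)

/-- `(x,u)` is a special labeled finite trajectory: `(x_k, x_{k+1}) ∈ G₀(u_k)` for all `k`. -/
def SpecialLabeled {n : ℕ} (x : Fin (n + 1) → ℝ) (u : Fin n → M.A) : Prop :=
  ∀ i : Fin n, (x i.castSucc, x i.succ) ∈ M.G0 (u i)

/-- A word `u ∈ L_n` is essential if the set of finite trajectories specially labeled
by `u` is open in `X_{n+1}`. -/
def EssentialWord {n : ℕ} (u : Fin n → M.A) : Prop :=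
  u ∈ M.Lang n ∧ IsOpen {x : M.finTraj (n + 1) | M.SpecialLabeled x.1 u}

/-- A symbol is essential if it appears in some essential word. -/
def EssentialSymbol (a : M.A) : Prop :=
  ∃ n : ℕ, ∃ u : Fin n → M.A, M.EssentialWord u ∧ ∃ i : Fin n, u i = a

/-- `A^(e)`, the set of essential symbols. -/
def Ess : Set M.A := {a | M.EssentialSymbol a}

/-- `E`, the set of essential symbolic sequences. -/
def E : Set (ℕ → M.A) := {z ∈ M.SFT | ∀ i : ℕ, z i ∈ M.Ess}

/-- A word all of whose letters lie in `C`, in the language of `Σ_M`. -/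
def WordOver {n : ℕ} (u : Fin n → M.A) (C : Set M.A) : Prop :=
  u ∈ M.Lang n ∧ ∀ i, u i ∈ C

/-- There is a word of length `n+1` over `C` beginning with `a` and ending with `b`. -/
def WordFromTo (C : Set M.A) (a b : M.A) (n : ℕ) : Prop :=
  ∃ u : Fin (n + 1) → M.A, M.WordOver u C ∧ u 0 = a ∧ u (Fin.last n) = b

/-- `C ⊆ A` is irreducible. -/
def IrreducibleSet (C : Set M.A) : Prop :=
  ∀ a ∈ C, ∀ b ∈ C, ∃ n : ℕ, M.WordFromTo C a b n

/-- `C` is an irreducible component (a maximal irreducible subset of `A`). -/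
def IrreducibleComponent (C : Set M.A) : Prop :=
  M.IrreducibleSet C ∧ ∀ C' : Set M.A, M.IrreducibleSet C' → C ⊆ C' → C' = C

/-- `C ⊆ A` is mixing. -/
def MixingSet (C : Set M.A) : Prop :=
  ∃ N : ℕ, 1 ≤ N ∧ ∀ a ∈ C, ∀ b ∈ C, ∀ n : ℕ, N ≤ n + 1 → M.WordFromTo C a b n

/-- `C` is a mixing component (a maximal mixing subset of `A`). -/
def MixingComponent (C : Set M.A) : Prop :=
  M.MixingSet C ∧ ∀ C' : Set M.A, M.MixingSet C' → C ⊆ C' → C' = C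

/-- The Irreducibility Condition (IC). -/
def IC : Prop := ∃ C : Set M.A, M.IrreducibleComponent C ∧ M.Ess ⊆ C

/-- The Mixing Condition (MC). -/
def MC : Prop := ∃ C : Set M.A, M.MixingComponent C ∧ M.Ess ⊆ C

/-- `Z` is a subshift of `Σ_M`: shift-invariant and closed in the product of discrete
topologies (closedness phrased combinatorially). -/
def IsSubshift (Z : Set (ℕ → M.A)) : Prop :=
  Z ⊆ M.SFT ∧ (∀ z ∈ Z, (fun k => z (k + 1)) ∈ Z) ∧
  ∀ x : ℕ → M.A, (∀ n : ℕ, ∃ z ∈ Z, ∀ i, i < n → z i = x i) → x ∈ Z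

/-- The symbol `a` occurs in some point of `Z`. -/
def SymbolInShift (Z : Set (ℕ → M.A)) (a : M.A) : Prop := ∃ z ∈ Z, ∃ k : ℕ, z k = a

/-- `Z` is transitive on symbols. -/
def TransitiveOnSymbols (Z : Set (ℕ → M.A)) : Prop :=
  ∀ a b : M.A, M.SymbolInShift Z a → M.SymbolInShift Z b →
    ∃ z ∈ Z, ∃ m n : ℕ, z m = a ∧ z (m + n) = b

end MarkovMultiMap

/-- The composition `g_{u₀} ∘ ⋯ ∘ g_{u_n}` of inverse maps along a list of symbols. -/
def gWordList (M : MarkovMultiMap) : List M.A → ℝ → ℝ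
  | [], x => x
  | a :: l, x => M.g a (gWordList M l x)

namespace MarkovMultiMap

/-- The inverse map `g_u` associated to a word `u = u₀⋯u_n`. -/
def gWord (M : MarkovMultiMap) {n : ℕ} (u : Fin (n + 1) → M.A) : ℝ → ℝ :=
  gWordList M (List.ofFn u)

/-- The interval `I_u = g_u(R(u_n))`. -/
def Iword (M : MarkovMultiMap) {n : ℕ} (u : Fin (n + 1) → M.A) : Set ℝ :=
  M.gWord u '' M.R (u (Fin.last n))

/-- The Coding Condition (CC). -/
def CC (M : MarkovMultiMap) : Prop :=
  ∃ Z : Set (ℕ → M.A), M.IsSubshift Z ∧ M.TransitiveOnSymbols Z ∧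
    (∀ y ∈ Set.Icc (0 : ℝ) 1, ∃ a ∈ Z, ∃ x ∈ M.X, x 0 = y ∧
      ∀ i : ℕ, (x i, x (i + 1)) ∈ M.Gr (a i)) ∧
    (∀ ε : ℝ, 0 < ε → ∃ N : ℕ, ∀ n : ℕ, N ≤ n → ∀ u : Fin (n + 1) → M.A,
      M.WordIn u Z → intervalLen (M.Iword u) < ε)

/-- Uniform equicontinuity of the family `{g_u : u ∈ L(C)}`. -/
def UnifEquicontOn (M : MarkovMultiMap) (C : Set M.A) : Prop :=
  ∀ ε : ℝ, 0 < ε → ∃ δ : ℝ, 0 < δ ∧ ∀ n : ℕ, ∀ u : Fin (n + 1) → M.A, M.WordOver u C →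
    ∀ x ∈ M.R (u (Fin.last n)), ∀ y ∈ M.R (u (Fin.last n)),
      |x - y| < δ → |M.gWord u x - M.gWord u y| < ε

end MarkovMultiMap

/-- A continuous topologically transitive self-map of a compact Hausdorff space is surjective. -/
theorem TopTransitive.surjective {α : Type*} [TopologicalSpace α] [CompactSpace α] [T2Space α]
    {T : α → α} (hT : TopTransitive T) (hc : Continuous T) : Function.Surjective T := by
  intro w
  by_contra hw
  have hne : T w ≠ w := fun h => hw ⟨w, h⟩
  obtain ⟨B, A, hB, hA, hTw, hwA, hdisj⟩ := t2_separation hne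
  have hW : IsOpen (range T)ᶜ := (isCompact_range hc).isClosed.isOpen_compl
  obtain ⟨n, z, ⟨b, hb, rfl⟩, hzW, hzA⟩ :=
    hT B ((range T)ᶜ ∩ A) hB (hW.inter hA) ⟨_, hTw⟩ ⟨w, hw, hwA⟩
  cases n with
  | zero => exact disjoint_left.mp hdisj hb hzA
  | succ n =>
    rw [Function.iterate_succ_apply'] at hzW
    exact hzW ⟨_, rfl⟩

/-- If `r` is total on `E`, then a finite portion of a backward `r`-trajectory in `E`, read in
reverse, extends to a forward `r`-trajectory in `E`. -/
theorem exists_trajectory_extending_reverse {α : Type*} {E : Set α} {r : α → α → Prop}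
    (hr : ∀ a ∈ E, ∃ b ∈ E, r a b) {y : ℕ → α} (hyE : ∀ k, y k ∈ E)
    (hy : ∀ k, r (y (k + 1)) (y k)) (L : ℕ) :
    ∃ x : ℕ → α, (∀ k, x k ∈ E) ∧ (∀ k, r (x k) (x (k + 1))) ∧ ∀ i ≤ L, x (L - i) = y i := by
  induction L with
  | zero =>
    choose! s hsE hs using hr
    have hE : ∀ k, s^[k] (y 0) ∈ E := by
      intro k
      induction k with
      | zero => exact hyE 0
      | succ k ih => rw [Function.iterate_succ_apply']; exact hsE _ ih
    refine ⟨fun k => s^[k] (y 0), hE, fun k => ?_, fun i hi => ?_⟩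
    · simp only [Function.iterate_succ_apply']
      exact hs _ (hE k)
    · obtain rfl : i = 0 := by omega
      rfl
  | succ L ih =>
    obtain ⟨x, hxE, hx, hxy⟩ := ih
    refine ⟨fun k => Nat.casesOn k (y (L + 1)) x, fun k => ?_, fun k => ?_, fun i hi => ?_⟩
    · cases k with
      | zero => exact hyE _
      | succ k => exact hxE k
    · cases k with
      | zero =>
        have h0 : x 0 = y L := by simpa using hxy L le_rfl
        simpa [h0] using hy L
      | succ k => exact hx k
    · rcases Nat.lt_or_ge L i with h | h
      · obtain rfl : i = L + 1 := by omega
        simp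
      · rw [Nat.succ_sub h]
        exact hxy i h

namespace MarkovMultiMap

variable (M : MarkovMultiMap)

theorem isClosed_GF : IsClosed M.GF := by
  have := M.finA
  refine isClosed_iUnion_of_finite fun a => ?_
  by_cases h0 : a ∈ M.A0
  · obtain ⟨p, -, q, -, -, -, hD⟩ := M.D_A0 a h0
    have hDc : IsCompact (M.D a) := hD ▸ isCompact_Icc
    have hGr : M.Gr a = (fun t => (t, M.f a t)) '' M.D a := by
      rw [M.Gr_A0 a h0]
      ext ⟨s, t⟩
      constructor
      · rintro ⟨hs, ht⟩
        exact ⟨s, hs, Prod.ext rfl ht.symm⟩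
      · rintro ⟨_, hs, h⟩
        obtain ⟨rfl, rfl⟩ := Prod.mk.inj h
        exact ⟨hs, rfl⟩
    rw [hGr]
    exact (hDc.image_of_continuousOn (continuousOn_id.prodMk (M.f_homeo a h0).1)).isClosed
  · have h12 : a ∈ M.A1 ∪ M.A2 := (M.A_cover a).resolve_left h0
    obtain ⟨p, -, hD⟩ := M.D_A12 a h12
    rw [M.Gr_A12 a h12, hD]
    refine isClosed_singleton.prod ?_
    rcases h12 with h1 | h2
    · obtain ⟨u, -, v, -, -, hR, -⟩ := M.R_A1 a h1
      exact hR ▸ isClosed_Icc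
    · obtain ⟨u, -, hR⟩ := M.R_A2 a h2
      exact hR ▸ isClosed_singleton

theorem exists_mem_GF {s : ℝ} (hs : s ∈ Icc (0 : ℝ) 1) :
    ∃ t ∈ Icc (0 : ℝ) 1, (s, t) ∈ M.GF := by
  rw [M.cover] at hs
  obtain ⟨a, ha⟩ := mem_iUnion.mp hs
  by_cases h0 : a ∈ M.A0
  · obtain ⟨u, hu, v, hv, -, hR⟩ := M.R_A0 a h0
    have hf := (M.f_homeo a h0).2.mapsTo ha
    rw [hR] at hf
    refine ⟨M.f a s, Icc_subset_Icc (M.P_sub hu).1 (M.P_sub hv).2 hf, mem_iUnion.mpr ⟨a, ?_⟩⟩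
    rw [M.Gr_A0 a h0]
    exact ⟨ha, rfl⟩
  · have h12 : a ∈ M.A1 ∪ M.A2 := (M.A_cover a).resolve_left h0
    obtain ⟨u, hu, huR⟩ : ∃ u ∈ M.P, u ∈ M.R a := by
      rcases h12 with h1 | h2
      · obtain ⟨u, hu, v, -, huv, hR, -⟩ := M.R_A1 a h1
        exact ⟨u, hu, hR ▸ left_mem_Icc.mpr huv.le⟩
      · obtain ⟨u, hu, hR⟩ := M.R_A2 a h2
        exact ⟨u, hu, hR ▸ mem_singleton u⟩
    refine ⟨u, M.P_sub hu, mem_iUnion.mpr ⟨a, ?_⟩⟩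
    rw [M.Gr_A12 a h12]
    exact ⟨ha, huR⟩

theorem isCompact_X : IsCompact M.X := by
  have hX : M.X = (univ.pi fun _ : ℕ => Icc (0 : ℝ) 1) ∩
      ⋂ k : ℕ, (fun x : ℕ → ℝ => (x k, x (k + 1))) ⁻¹' M.GF := by
    ext x
    simp only [X, mem_ofPred_eq, mem_inter_iff, mem_univ_pi, mem_iInter, mem_preimage]
  rw [hX]
  refine (isCompact_univ_pi fun _ => isCompact_Icc).inter_right (isClosed_iInter fun k => ?_)
  exact M.isClosed_GF.preimage (by fun_prop)

theorem continuous_shift : Continuous M.shift :=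
  continuous_induced_rng.mpr (continuous_pi fun k =>
    (continuous_apply (k + 1)).comp continuous_subtype_val)

theorem shift_iterate_apply (n : ℕ) (x : M.X) (k : ℕ) : (M.shift^[n] x).1 k = x.1 (n + k) := by
  induction n generalizing x with
  | zero => simp
  | succ n ih =>
    rw [Function.iterate_succ_apply, ih, Nat.add_right_comm]
    rfl

theorem ishift_iterate_apply (n : ℕ) (y : M.Y) (k : ℕ) : (M.ishift^[n] y).1 k = y.1 (n + k) := by
  induction n generalizing y with
  | zero => simp
  | succ n ih =>
    rw [Function.iterate_succ_apply, ih, Nat.add_right_comm]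
    rfl

theorem exists_mem_X_extending {y : ℕ → ℝ} (hy : y ∈ M.Y) (L : ℕ) :
    ∃ x ∈ M.X, ∀ i ≤ L, x (L - i) = y i := by
  obtain ⟨x, hx, hxG, hxy⟩ := exists_trajectory_extending_reverse
    (r := fun s t => (s, t) ∈ M.GF) (fun _ hs => M.exists_mem_GF hs) hy.1 hy.2 L
  exact ⟨x, ⟨hx, hxG⟩, hxy⟩

theorem exists_mem_GF_of_surjective (hT : Function.Surjective M.shift) {t : ℝ}
    (ht : t ∈ Icc (0 : ℝ) 1) : ∃ s ∈ Icc (0 : ℝ) 1, (s, t) ∈ M.GF := by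
  choose! s hsE hs using fun a (ha : a ∈ Icc (0 : ℝ) 1) => M.exists_mem_GF ha
  have hE : ∀ k, s^[k] t ∈ Icc (0 : ℝ) 1 := by
    intro k
    induction k with
    | zero => exact ht
    | succ k ih => rw [Function.iterate_succ_apply']; exact hsE _ ih
  have hX : (fun k => s^[k] t) ∈ M.X :=
    ⟨hE, fun k => by simpa only [Function.iterate_succ_apply'] using hs _ (hE k)⟩
  obtain ⟨z, hz⟩ := hT ⟨_, hX⟩
  have hz1 : z.1 1 = t := congrFun (congrArg Subtype.val hz) 0
  exact ⟨z.1 0, z.2.1 0, hz1 ▸ z.2.2 0⟩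

theorem exists_mem_Y_extending (hT : Function.Surjective M.shift) {x : ℕ → ℝ} (hx : x ∈ M.X)
    (L : ℕ) : ∃ y ∈ M.Y, ∀ i ≤ L, y (L - i) = x i := by
  obtain ⟨y, hy, hyG, hyx⟩ := exists_trajectory_extending_reverse
    (r := fun s t => (t, s) ∈ M.GF) (fun _ ht => M.exists_mem_GF_of_surjective hT ht) hx.1 hx.2 L
  exact ⟨y, ⟨hy, hyG⟩, hyx⟩

/-- Near a point of an open subset `U` of `Y`, membership in `U` is detected by an open condition
on the forward trajectories which end with the reversed initial coordinates. -/
theorem exists_open_forward_cylinder {U : Set M.Y} (hU : IsOpen U) (hne : U.Nonempty) :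
    ∃ N : ℕ, ∀ L ≥ N, ∃ C : Set M.X, IsOpen C ∧ C.Nonempty ∧
      ∀ x ∈ C, ∀ y : M.Y, (∀ i ≤ L, y.1 i = x.1 (L - i)) → y ∈ U := by
  obtain ⟨U', hU', rfl⟩ := isOpen_induced_iff.mp hU
  obtain ⟨u, hu⟩ := hne
  obtain ⟨I, w, hw, hIw⟩ := isOpen_pi_iff.mp hU' u.1 hu
  refine ⟨I.sup id, fun L hL => ?_⟩
  have hIL : ∀ i ∈ I, i ≤ L := fun i hi => (Finset.le_sup (f := id) hi).trans hL
  refine ⟨⋂ i ∈ I, (fun x : M.X => x.1 (L - i)) ⁻¹' w i, ?_, ?_, ?_⟩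
  · exact isOpen_biInter_finset fun i hi => (hw i hi).1.preimage
      ((continuous_apply (L - i)).comp continuous_subtype_val)
  · obtain ⟨x, hx, hxu⟩ := M.exists_mem_X_extending u.2 L
    refine ⟨⟨x, hx⟩, mem_iInter₂.mpr fun i hi => ?_⟩
    simpa only [mem_preimage, hxu i (hIL i hi)] using (hw i hi).2
  · intro x hx y hxy
    refine hIw fun i hi => ?_
    rw [hxy i (hIL i hi)]
    exact mem_iInter₂.mp hx i hi

end MarkovMultiMap

/-- If the forward trajectory system `(X,T)` is topologically transitive, then the
inverse limit system `(Y,S)` is topologically transitive. -/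
theorem stmt18 (M : MarkovMultiMap) (hpp : M.ProperlyParametrized)
    (htrans : TopTransitive M.shift) : TopTransitive M.ishift := by
  intro U V hU hV hUne hVne
  have : CompactSpace M.X := isCompact_iff_compactSpace.mp M.isCompact_X
  have hsurj := htrans.surjective M.continuous_shift
  obtain ⟨N₁, hN₁⟩ := M.exists_open_forward_cylinder hU hUne
  obtain ⟨N₂, hN₂⟩ := M.exists_open_forward_cylinder hV hVne
  obtain ⟨CU, hCU, hCUne, hCUU⟩ := hN₁ (max N₁ N₂) (le_max_left _ _)
  obtain ⟨CV, hCV, hCVne, hCVV⟩ := hN₂ (max N₁ N₂) (le_max_right _ _)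
  generalize max N₁ N₂ = L at *
  obtain ⟨n, -, ⟨x, hxV, rfl⟩, hxU⟩ := htrans CV CU hCV hCU hCVne hCUne
  obtain ⟨y, hy, hyx⟩ := M.exists_mem_Y_extending hsurj x.2 (n + L)
  refine ⟨n, _, ⟨⟨y, hy⟩, hCUU _ hxU _ fun i hi => ?_, rfl⟩, hCVV x hxV _ fun i hi => ?_⟩
  · rw [M.shift_iterate_apply, ← hyx (n + (L - i)) (by omega)]
    exact congrArg y (by omega)
  · rw [M.ishift_iterate_apply, ← hyx (L - i) (by omega)]
    exact congrArg y (by omega)
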